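/- Under the stated assumptions, the function W₂ is four times continuously differentiable on ℝ^d and satisfies the second-order effective field equation Σ_{l,m=1}^d μ⁰_{lm} ∂²W₂/∂x_l∂x_m (x) + ε² Σ_{l,m,p,q=1}^d μ²_{lmpq} ∂⁴W₂/∂x_l∂x_m∂x_p∂x_q (x) + ρ⁰ σ Ω̂² W₂(x) = −ρ⁰ (2π)^{−d/2} ∫_{ℝ^d} F(k) e^{i k·x} dk for every x ∈ ℝ^d (the right-hand side being −ρ⁰ times the inverse Fourier transform of F). -/

import Mathlib

open MeasureTheory Complex Real Filter ComplexConjugate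

noncomputable section

/-- The Euclidean inner product on `ℝ^d`. -/
def dotE (d : ℕ) (k x : Fin d → ℝ) : ℝ := ∑ i, k i * x i

/-- Partial derivative `∂_l f` of a complex-valued function on `ℝ^d`. -/
def pdC (d : ℕ) (l : Fin d) (f : (Fin d → ℝ) → ℂ) (x : Fin d → ℝ) : ℂ :=
  fderiv ℝ f x (Pi.single l 1)

/-- Second partial derivative `∂²f/∂x_l∂x_m` of a complex-valued function on `ℝ^d`. -/
def pd2C (d : ℕ) (l m : Fin d) (f : (Fin d → ℝ) → ℂ) (x : Fin d → ℝ) : ℂ :=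
  pdC d l (fun y => pdC d m f y) x

/-- Fourth partial derivative `∂⁴f/∂x_l∂x_m∂x_p∂x_q` of a complex-valued function on `ℝ^d`. -/
def pd4C (d : ℕ) (l m p q : Fin d) (f : (Fin d → ℝ) → ℂ) (x : Fin d → ℝ) : ℂ :=
  pdC d l (fun y => pdC d m (fun z => pdC d p (fun w => pdC d q f w) z) y) x

open scoped FourierTransform

/-- The pairing `(k, x) ↦ -(k · x) / (2π)`, for which the vector Fourier integral has kernel
`exp (i k · x)`. -/
def waveForm (d : ℕ) : (Fin d → ℝ) →L[ℝ] (Fin d → ℝ) →L[ℝ] ℝ :=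
  (-(2 * π)⁻¹) • ∑ i, (ContinuousLinearMap.proj (R := ℝ) (φ := fun _ : Fin d => ℝ) i).smulRight
    (ContinuousLinearMap.proj (R := ℝ) (φ := fun _ : Fin d => ℝ) i)

lemma waveForm_apply (d : ℕ) (k x : Fin d → ℝ) : waveForm d k x = -(2 * π)⁻¹ * dotE d k x := by
  simp [waveForm, dotE]

lemma fourierChar_neg_waveForm (d : ℕ) (k x : Fin d → ℝ) :
    (𝐞 (-waveForm d k x) : ℂ) = Complex.exp (Complex.I * ((dotE d k x : ℝ) : ℂ)) := by
  have hπ : (π : ℂ) ≠ 0 := by exact_mod_cast Real.pi_ne_zero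
  rw [Real.fourierChar_apply, waveForm_apply]
  congr 1
  push_cast
  field_simp

lemma fourierIntegral_waveForm (d : ℕ) (f : (Fin d → ℝ) → ℂ) :
    VectorFourier.fourierIntegral 𝐞 volume (waveForm d).toLinearMap₁₂ f =
      fun x => ∫ k, f k * Complex.exp (Complex.I * ((dotE d k x : ℝ) : ℂ)) := by
  ext x
  refine integral_congr_ae (.of_forall fun k => ?_)
  change 𝐞 (-waveForm d k x) • f k = _
  rw [Circle.smul_def, fourierChar_neg_waveForm, smul_eq_mul, mul_comm]

@[fun_prop]
lemma continuous_dotE_left (d : ℕ) (x : Fin d → ℝ) : Continuous fun k => dotE d k x := by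
  unfold dotE
  fun_prop

lemma integrable_norm_pow_mul {d : ℕ} {f : (Fin d → ℝ) → ℂ} (hf : Continuous f)
    (hfs : HasCompactSupport f) (n : ℕ) : Integrable fun k => ‖k‖ ^ n * ‖f k‖ :=
  Continuous.integrable_of_hasCompactSupport (by fun_prop) hfs.norm.mul_left

lemma contDiff_integral_mul_exp_dotE {d : ℕ} {f : (Fin d → ℝ) → ℂ} (hf : Continuous f)
    (hfs : HasCompactSupport f) (n : ℕ) :
    ContDiff ℝ n fun x => ∫ k, f k * Complex.exp (Complex.I * ((dotE d k x : ℝ) : ℂ)) := by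
  rw [← fourierIntegral_waveForm]
  exact VectorFourier.contDiff_fourierIntegral (N := n) (waveForm d)
    fun m _ => integrable_norm_pow_mul hf hfs m

lemma pdC_const_mul_integral_mul_exp_dotE {d : ℕ} {f : (Fin d → ℝ) → ℂ} (hf : Continuous f)
    (hfs : HasCompactSupport f) (c : ℂ) (l : Fin d) (x : Fin d → ℝ) :
    pdC d l (fun x => c * ∫ k, f k * Complex.exp (Complex.I * ((dotE d k x : ℝ) : ℂ))) x =
      c * ∫ k, Complex.I * ((k l : ℝ) : ℂ) * f k *
        Complex.exp (Complex.I * ((dotE d k x : ℝ) : ℂ)) := by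
  have hderiv := VectorFourier.hasFDerivAt_fourierIntegral (waveForm d)
    (hf.integrable_of_hasCompactSupport hfs)
    (by simpa using integrable_norm_pow_mul hf hfs 1) x
  have hint : Integrable fun k =>
      𝐞 (-waveForm d k x) • VectorFourier.fourierSMulRight (waveForm d) f k := by
    refine (VectorFourier.fourierIntegral_convergent_iff continuous_fourierChar
      (L := (waveForm d).toLinearMap₁₂) (waveForm d).continuous₂ x).2 ?_
    have haux : Continuous fun p : ((Fin d → ℝ) →L[ℝ] ℝ) × ℂ => p.1.smulRight p.2 :=
      (ContinuousLinearMap.smulRightL ℝ (Fin d → ℝ) ℂ).continuous₂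
    refine Continuous.integrable_of_hasCompactSupport
      (f := VectorFourier.fourierSMulRight (waveForm d) f)
      ((haux.comp ((waveForm d).continuous.prodMk hf)).const_smul (-(2 * π * Complex.I)))
      (hfs.mono fun k hk hk0 => ?_)
    exact hk (by ext w; simp [VectorFourier.fourierSMulRight_apply, hk0])
  rw [fourierIntegral_waveForm] at hderiv
  rw [pdC, (hderiv.const_mul c).fderiv, _root_.smul_apply, smul_eq_mul]
  congr 1
  refine (ContinuousLinearMap.integral_apply hint _).trans
    (integral_congr_ae (.of_forall fun k => ?_))
  have hπ : (π : ℂ) ≠ 0 := by exact_mod_cast Real.pi_ne_zero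
  have hdot : dotE d k (Pi.single l 1) = k l := by simp [dotE, Pi.single_apply]
  change 𝐞 (-waveForm d k x) • VectorFourier.fourierSMulRight (waveForm d) f k _ = _
  rw [Circle.smul_def, fourierChar_neg_waveForm, VectorFourier.fourierSMulRight_apply,
    waveForm_apply, hdot]
  simp only [smul_eq_mul, Complex.real_smul]
  push_cast
  field_simp

/-- The inverse Fourier integral at `x` of the product of a symbol `P` with a fixed continuous,
compactly supported function `G`, as a linear functional of `P`. -/
def symbolIntegral {d : ℕ} {G : (Fin d → ℝ) → ℂ} (hG : Continuous G) (hGs : HasCompactSupport G)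
    (x : Fin d → ℝ) : C(Fin d → ℝ, ℂ) →ₗ[ℂ] ℂ where
  toFun P := ∫ k, P k * G k * Complex.exp (Complex.I * ((dotE d k x : ℝ) : ℂ))
  map_add' P Q := by
    have hint (R : C(Fin d → ℝ, ℂ)) : Integrable fun k =>
        R k * G k * Complex.exp (Complex.I * ((dotE d k x : ℝ) : ℂ)) :=
      Continuous.integrable_of_hasCompactSupport (by fun_prop) hGs.mul_left.mul_right
    rw [← integral_add (hint P) (hint Q)]
    simp only [ContinuousMap.add_apply, add_mul]
  map_smul' a P := by
    rw [RingHom.id_apply, smul_eq_mul, ← integral_const_mul]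
    simp only [ContinuousMap.smul_apply, smul_eq_mul, mul_assoc]

lemma symbolIntegral_apply {d : ℕ} {G : (Fin d → ℝ) → ℂ} (hG : Continuous G)
    (hGs : HasCompactSupport G) (x : Fin d → ℝ) (P : C(Fin d → ℝ, ℂ)) :
    symbolIntegral hG hGs x P =
      ∫ k, P k * G k * Complex.exp (Complex.I * ((dotE d k x : ℝ) : ℂ)) := rfl

/-- The symbol `k ↦ k_l`. -/
def coordSymbol {d : ℕ} (l : Fin d) : C(Fin d → ℝ, ℂ) := ⟨fun k => ((k l : ℝ) : ℂ), by fun_prop⟩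

@[simp]
lemma coordSymbol_apply {d : ℕ} (l : Fin d) (k : Fin d → ℝ) :
    coordSymbol l k = ((k l : ℝ) : ℂ) := rfl

lemma pdC_symbolIntegral {d : ℕ} {G : (Fin d → ℝ) → ℂ} (hG : Continuous G)
    (hGs : HasCompactSupport G) (c : ℂ) (l : Fin d) (P : C(Fin d → ℝ, ℂ)) (x : Fin d → ℝ) :
    pdC d l (fun y => c * symbolIntegral hG hGs y P) x =
      c * Complex.I * symbolIntegral hG hGs x (coordSymbol l * P) := by
  simp only [symbolIntegral_apply]
  rw [pdC_const_mul_integral_mul_exp_dotE (f := fun k => P k * G k) (by fun_prop) hGs.mul_left,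
    mul_assoc c, ← integral_const_mul Complex.I]
  simp only [ContinuousMap.mul_apply, coordSymbol_apply, mul_assoc]

lemma pd2C_symbolIntegral {d : ℕ} {G : (Fin d → ℝ) → ℂ} (hG : Continuous G)
    (hGs : HasCompactSupport G) (c : ℂ) (l m : Fin d) (P : C(Fin d → ℝ, ℂ)) (x : Fin d → ℝ) :
    pd2C d l m (fun y => c * symbolIntegral hG hGs y P) x =
      -c * symbolIntegral hG hGs x (coordSymbol l * (coordSymbol m * P)) := by
  simp only [pd2C, pdC_symbolIntegral]
  rw [mul_assoc c, Complex.I_mul_I, mul_neg_one]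

lemma pd4C_symbolIntegral {d : ℕ} {G : (Fin d → ℝ) → ℂ} (hG : Continuous G)
    (hGs : HasCompactSupport G) (c : ℂ) (l m p q : Fin d) (P : C(Fin d → ℝ, ℂ))
    (x : Fin d → ℝ) :
    pd4C d l m p q (fun y => c * symbolIntegral hG hGs y P) x =
      c * symbolIntegral hG hGs x
        (coordSymbol l * (coordSymbol m * (coordSymbol p * (coordSymbol q * P)))) := by
  change pd2C d l m (fun y => pd2C d p q (fun z => c * symbolIntegral hG hGs z P) y) x = _
  simp only [pd2C_symbolIntegral, neg_neg]

lemma continuous_div_of_ne_zero_on_tsupport {X : Type*} [TopologicalSpace X] {f g : X → ℂ}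
    (hf : Continuous f) (hg : Continuous g) (h : ∀ x ∈ tsupport f, g x ≠ 0) :
    Continuous fun x => f x / g x :=
  continuous_of_tsupport fun x hx => hf.continuousAt.div hg.continuousAt <| h x <|
    closure_mono (Function.support_subset_iff'.2 fun y hy => by
      simp [Function.notMem_support.1 hy]) hx

/-- the second-order mean field `W₂` is `C⁴` and satisfies the effective equation
`Σ μ⁰_{lm} ∂²W₂/∂x_l∂x_m + ε² Σ μ²_{lmpq} ∂⁴W₂/∂x_l∂x_m∂x_p∂x_q + ρ⁰ σ Ω̂² W₂
  = −ρ⁰ (2π)^{−d/2} ∫ F(k) e^{ik·x} dk`. -/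
theorem second_order_effective_equation (d : ℕ) (hd : 1 ≤ d)
    (F : (Fin d → ℝ) → ℂ) (hFcont : Continuous F) (hFcomp : HasCompactSupport F)
    (μ0 : Fin d → Fin d → ℝ) (hμ0symm : ∀ l m, μ0 l m = μ0 m l)
    (μ2 : Fin d → Fin d → Fin d → Fin d → ℝ)
    (ρ0 : ℝ) (hρ0 : ρ0 ≠ 0) (σ : ℝ) (hσ : σ = 1 ∨ σ = -1) (Ω : ℝ)
    (ε : ℝ) (hε : 0 < ε)
    (D2 : (Fin d → ℝ) → ℝ)
    (hD2def : ∀ k : Fin d → ℝ,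
      D2 k = (1 / ρ0) * (∑ l, ∑ m, μ0 l m * k l * k m) -
        (ε ^ 2 / ρ0) * (∑ l, ∑ m, ∑ p, ∑ q, μ2 l m p q * k l * k m * k p * k q) -
        σ * Ω ^ 2)
    (hD2 : ∀ k ∈ tsupport F, D2 k ≠ 0)
    (W2 : (Fin d → ℝ) → ℂ)
    (hW2 : ∀ x : Fin d → ℝ,
      W2 x = (((2 * π) ^ (-(d : ℝ) / 2) : ℝ) : ℂ) *
        ∫ k : Fin d → ℝ,
          F k * Complex.exp (Complex.I * ((dotE d k x : ℝ) : ℂ)) / ((D2 k : ℝ) : ℂ)) :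
    ContDiff ℝ 4 W2 ∧
    ∀ x : Fin d → ℝ,
      (∑ l, ∑ m, ((μ0 l m : ℝ) : ℂ) * pd2C d l m W2 x) +
          ((ε ^ 2 : ℝ) : ℂ) *
            (∑ l, ∑ m, ∑ p, ∑ q, ((μ2 l m p q : ℝ) : ℂ) * pd4C d l m p q W2 x) +
          ((ρ0 : ℝ) : ℂ) * ((σ : ℝ) : ℂ) * ((Ω ^ 2 : ℝ) : ℂ) * W2 x =
        -(((ρ0 : ℝ) : ℂ)) * ((((2 * π) ^ (-(d : ℝ) / 2) : ℝ) : ℂ) *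
          ∫ k : Fin d → ℝ, F k * Complex.exp (Complex.I * ((dotE d k x : ℝ) : ℂ))) := by
  have hD2cont : Continuous fun k => ((D2 k : ℝ) : ℂ) := by
    rw [funext hD2def]
    fun_prop
  have hD2ne : ∀ k ∈ tsupport F, ((D2 k : ℝ) : ℂ) ≠ 0 := fun k hk => by exact_mod_cast hD2 k hk
  have hG : Continuous fun k => F k / ((D2 k : ℝ) : ℂ) :=
    continuous_div_of_ne_zero_on_tsupport hFcont hD2cont hD2ne
  have hGs : HasCompactSupport fun k => F k / ((D2 k : ℝ) : ℂ) :=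
    hFcomp.mono fun k hk hk0 => hk (by simp [hk0])
  set c : ℂ := (((2 * π) ^ (-(d : ℝ) / 2) : ℝ) : ℂ)
  have hW : W2 = fun x => c * symbolIntegral hG hGs x 1 := by
    ext x
    simp only [hW2, symbolIntegral_apply, ContinuousMap.one_apply, one_mul, div_mul_eq_mul_div]
  refine ⟨?_, fun x => ?_⟩
  · rw [hW]
    simp only [symbolIntegral_apply, ContinuousMap.one_apply, one_mul]
    exact contDiff_const.mul (contDiff_integral_mul_exp_dotE hG hGs 4)
  have hsymbol : symbolIntegral hG hGs x
      (-∑ l, ∑ m, ((μ0 l m : ℝ) : ℂ) • (coordSymbol l * (coordSymbol m * 1)) +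
        ((ε ^ 2 : ℝ) : ℂ) • ∑ l, ∑ m, ∑ p, ∑ q, ((μ2 l m p q : ℝ) : ℂ) •
          (coordSymbol l * (coordSymbol m * (coordSymbol p * (coordSymbol q * 1)))) +
        (((ρ0 : ℝ) : ℂ) * ((σ : ℝ) : ℂ) * ((Ω ^ 2 : ℝ) : ℂ)) • 1) =
      -((ρ0 : ℝ) : ℂ) * ∫ k, F k * Complex.exp (Complex.I * ((dotE d k x : ℝ) : ℂ)) := by
    rw [symbolIntegral_apply, ← integral_const_mul]
    refine integral_congr_ae (.of_forall fun k => ?_)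
    by_cases hk : k ∈ tsupport F
    · have hρ : (ρ0 : ℂ) ≠ 0 := by exact_mod_cast hρ0
      have hD := hD2ne k hk
      have hmul : -((ρ0 : ℝ) : ℂ) * ((D2 k : ℝ) : ℂ) =
          -(∑ l, ∑ m, (μ0 l m : ℂ) * (k l * k m)) + (ε : ℂ) ^ 2 *
            (∑ l, ∑ m, ∑ p, ∑ q, (μ2 l m p q : ℂ) * (k l * (k m * (k p * k q)))) +
          ρ0 * σ * Ω ^ 2 := by
        rw [hD2def]
        push_cast
        simp only [mul_assoc]
        field_simp
        ring
      simp only [ContinuousMap.add_apply, ContinuousMap.neg_apply, ContinuousMap.smul_apply,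
        ContinuousMap.sum_apply, ContinuousMap.mul_apply, ContinuousMap.one_apply,
        coordSymbol_apply, smul_eq_mul, mul_one, Complex.ofReal_pow]
      rw [← hmul, mul_assoc (-(ρ0 : ℂ)), mul_div_cancel₀ _ hD, mul_assoc]
    · simp [image_eq_zero_of_notMem_tsupport hk]
  rw [mul_left_comm, ← hsymbol, hW]
  simp only [pd2C_symbolIntegral, pd4C_symbolIntegral, map_add, map_neg, map_sum, map_smul,
    smul_eq_mul, mul_add, mul_neg, Finset.mul_sum, neg_mul, Finset.sum_neg_distrib,
    mul_left_comm _ c]
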